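/- arXiv:math/0507595 — 2 statements merged into one kernel-verified Lean document; each statement's English description precedes it below -/
import Mathlib

section
/- Let R be a commutative ring with 1, let N be its nilradical, and let p : R → R/N be the quotient map. Let I be an ideal of R and h ∈ R. Then h is integrally dependent on I if and only if p(h) is integrally dependent on the image ideal p(I) = Ideal.map p I in R/N. -/
/-- `h` is integrally dependent on the ideal `I`: there is `k ≥ 1` and
`a j ∈ I ^ j` for `j = 1, …, k` with `h ^ k + ∑_{j=1}^k a j * h ^ (k - j) = 0`. -/
def IntegrallyDepOn {R : Type*} [CommRing R] (I : Ideal R) (h : R) : Prop :=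
  ∃ k : ℕ, 0 < k ∧ ∃ a : ℕ → R, (∀ j ∈ Finset.Icc 1 k, a j ∈ I ^ j) ∧
    h ^ k + ∑ j ∈ Finset.Icc 1 k, a j * h ^ (k - j) = 0

/-- The degree `n + 1` part of `I * (I + (h)) ^ n` consists of the combinations
`∑ a j * h ^ (n + 1 - j)` with `a j ∈ I ^ j` and `1 ≤ j`. -/
theorem exists_sum_of_mem_mul_sup_span_pow {R : Type*} [CommRing R] {I : Ideal R} {h : R} (n : ℕ)
    {x : R} (hx : x ∈ I * (I ⊔ Ideal.span {h}) ^ n) :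
    ∃ a : ℕ → R, (∀ j ∈ Finset.Icc 1 (n + 1), a j ∈ I ^ j) ∧
      x = ∑ j ∈ Finset.Icc 1 (n + 1), a j * h ^ (n + 1 - j) := by
  have hle : ∀ n : ℕ, I * (I ⊔ Ideal.span {h}) ^ n ≤
      ⨆ j ∈ Finset.Icc 1 (n + 1), I ^ j * Ideal.span {h ^ (n + 1 - j)} := by
    intro n
    induction n with
    | zero => simp
    | succ n ih =>
      rw [pow_succ, ← mul_assoc]
      refine (Ideal.mul_mono_left ih).trans ?_
      simp only [Ideal.iSup_mul, Ideal.mul_sup]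
      refine sup_le (iSup₂_le fun j hj ↦ ?_) (iSup₂_le fun j hj ↦ ?_) <;>
        obtain ⟨hj₁, hj₂⟩ := Finset.mem_Icc.mp hj
      · refine le_iSup₂_of_le (j + 1) (Finset.mem_Icc.mpr ⟨by omega, by omega⟩) (le_of_eq ?_)
        rw [show n + 1 + 1 - (j + 1) = n + 1 - j by omega]
        ring
      · refine le_iSup₂_of_le j (Finset.mem_Icc.mpr ⟨by omega, by omega⟩) (le_of_eq ?_)
        rw [show n + 1 + 1 - j = n + 1 - j + 1 by omega, pow_succ,
          ← Ideal.span_singleton_mul_span_singleton, mul_assoc]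
  obtain ⟨μ, hμ⟩ := (Submodule.mem_iSup_finset_iff_exists_sum _ _).mp (hle n hx)
  have hmem (j : ℕ) : ∃ a ∈ I ^ j, a * h ^ (n + 1 - j) = μ j :=
    Ideal.mem_mul_span_singleton.mp (μ j).2
  choose a ha haμ using hmem
  exact ⟨a, fun j _ ↦ ha j, by simp only [haμ, hμ]⟩

theorem sum_mem_mul_sup_span_pow {R : Type*} [CommRing R] {I : Ideal R} {h : R} (n : ℕ)
    {a : ℕ → R} (ha : ∀ j ∈ Finset.Icc 1 (n + 1), a j ∈ I ^ j) :
    ∑ j ∈ Finset.Icc 1 (n + 1), a j * h ^ (n + 1 - j) ∈ I * (I ⊔ Ideal.span {h}) ^ n := by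
  refine sum_mem fun j hj ↦ ?_
  obtain ⟨hj₁, hj₂⟩ := Finset.mem_Icc.mp hj
  obtain ⟨i, rfl⟩ := Nat.exists_eq_add_of_le' hj₁
  have hle : I ^ (i + 1) * Ideal.span {h} ^ (n - i) ≤ I * (I ⊔ Ideal.span {h}) ^ n := by
    calc I ^ (i + 1) * Ideal.span {h} ^ (n - i)
        = I * (I ^ i * Ideal.span {h} ^ (n - i)) := by ring
      _ ≤ I * ((I ⊔ Ideal.span {h}) ^ i * (I ⊔ Ideal.span {h}) ^ (n - i)) :=
        Ideal.mul_mono_right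
          (Ideal.mul_mono (Ideal.pow_right_mono le_sup_left _)
            (Ideal.pow_right_mono le_sup_right _))
      _ = I * (I ⊔ Ideal.span {h}) ^ n := by
        rw [← pow_add, Nat.add_sub_cancel' (by omega)]
  rw [Nat.add_sub_add_right]
  exact hle (Ideal.mul_mem_mul (ha _ hj)
    (Ideal.pow_mem_pow (Ideal.mem_span_singleton_self h) _))

theorem integrallyDepOn_of_pow_mem {R : Type*} [CommRing R] {I : Ideal R} {h : R} (n : ℕ)
    (hn : h ^ (n + 1) ∈ I * (I ⊔ Ideal.span {h}) ^ n) : IntegrallyDepOn I h := by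
  obtain ⟨a, ha, hsum⟩ := exists_sum_of_mem_mul_sup_span_pow n (neg_mem hn)
  exact ⟨n + 1, n.succ_pos, a, ha, by rw [← hsum, add_neg_cancel]⟩

/-- If `h ^ (n + 1) + s` is nilpotent with `s ∈ I * (I + (h)) ^ n`, then `h` is integrally
dependent on `I`. -/
theorem integrallyDepOn_of_isNilpotent {R : Type*} [CommRing R] {I : Ideal R} {h s : R} (n : ℕ)
    (hs : s ∈ I * (I ⊔ Ideal.span {h}) ^ n) (hnil : IsNilpotent (h ^ (n + 1) + s)) :
    IntegrallyDepOn I h := by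
  set L := I ⊔ Ideal.span {h}
  have hh : h ^ (n + 1) ∈ L ^ (n + 1) :=
    Ideal.pow_mem_pow (Ideal.mem_sup_right (Ideal.mem_span_singleton_self h)) _
  have hs' : s ∈ L ^ (n + 1) := by
    rw [pow_succ']
    exact Ideal.mul_mono_left le_sup_left hs
  have key (m : ℕ) : (h ^ (n + 1) + s) ^ (m + 1) - (h ^ (n + 1)) ^ (m + 1) ∈
      I * L ^ (n + (n + 1) * m) := by
    induction m with
    | zero => simpa using hs
    | succ m ih =>
      have h₁ := Ideal.mul_mem_mul ih (add_mem hh hs')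
      have h₂ := Ideal.mul_mem_mul hs (Ideal.pow_mem_pow hh (m + 1))
      rw [mul_assoc, ← pow_add, show n + (n + 1) * m + (n + 1) = n + (n + 1) * (m + 1) by ring]
        at h₁
      rw [mul_assoc, ← pow_mul, ← pow_add] at h₂
      convert add_mem h₁ h₂ using 1
      ring
  obtain ⟨m, hm⟩ := hnil
  have hmem := key m
  rw [pow_succ (h ^ (n + 1) + s), hm, zero_mul, zero_sub, neg_mem_iff, ← pow_mul,
    show (n + 1) * (m + 1) = n + (n + 1) * m + 1 by ring] at hmem
  exact integrallyDepOn_of_pow_mem _ hmem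

theorem IntegrallyDepOn.map {R S : Type*} [CommRing R] [CommRing S] {I : Ideal R} {h : R}
    (hI : IntegrallyDepOn I h) (f : R →+* S) : IntegrallyDepOn (I.map f) (f h) := by
  obtain ⟨k, hk, a, ha, hsum⟩ := hI
  refine ⟨k, hk, fun j ↦ f (a j), fun j hj ↦ ?_, ?_⟩
  · rw [← Ideal.map_pow]
    exact Ideal.mem_map_of_mem f (ha j hj)
  · simpa using congrArg f hsum

/-- `h` is integrally dependent on `I` iff its image modulo the nilradical is
integrally dependent on the image of `I`. -/
theorem integrallyDepOn_iff_quotient_nilradical {R : Type*} [CommRing R]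
    (I : Ideal R) (h : R) :
    IntegrallyDepOn I h ↔
      IntegrallyDepOn (I.map (Ideal.Quotient.mk (nilradical R)))
        (Ideal.Quotient.mk (nilradical R) h) := by
  refine ⟨fun hI ↦ hI.map _, ?_⟩
  rintro ⟨k, hk, b, hb, hsum⟩
  obtain ⟨n, rfl⟩ := Nat.exists_eq_add_of_le' hk
  have hlift (j : ℕ) : ∃ a, j ∈ Finset.Icc 1 (n + 1) →
      a ∈ I ^ j ∧ Ideal.Quotient.mk (nilradical R) a = b j := by
    by_cases hj : j ∈ Finset.Icc 1 (n + 1)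
    · have hbj := hb j hj
      rw [← Ideal.map_pow,
        Ideal.mem_map_iff_of_surjective _ Ideal.Quotient.mk_surjective] at hbj
      exact hbj.imp fun a ha _ ↦ ha
    · exact ⟨0, fun hj' ↦ absurd hj' hj⟩
  choose a ha using hlift
  refine integrallyDepOn_of_isNilpotent n
    (sum_mem_mul_sup_span_pow n fun j hj ↦ (ha j hj).1) ?_
  rw [← mem_nilradical, ← Ideal.Quotient.eq_zero_iff_mem, ← hsum]
  simp only [map_add, map_sum, map_mul, map_pow]
  exact congrArg _ (Finset.sum_congr rfl fun j hj ↦ by rw [(ha j hj).2])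
end

section
/- Let R be a commutative ring with 1, let N be its nilradical, let p : R → R/N be the quotient map, and let I be an ideal of R. Consider the ring homomorphism R[X] → (R/N)[X] that applies p to each coefficient. This homomorphism maps the Rees algebra of I (the subalgebra of R[X] consisting of polynomials whose i-th coefficient lies in I^i for every i) surjectively onto the Rees algebra of the image ideal Ideal.map p I in (R/N)[X], and every element of the Rees algebra of I that maps to 0 is nilpotent. -/
/-- A surjective ring homomorphism `φ` carries the Rees algebra of `I`, coefficientwise, onto the
Rees algebra of `I.map φ`. -/
theorem image_map_reesAlgebra_of_surjective {R S : Type*} [CommRing R] [CommRing S]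
    (I : Ideal R) {φ : R →+* S} (hφ : Function.Surjective φ) :
    Polynomial.map φ '' (reesAlgebra I : Set (Polynomial R)) =
      (reesAlgebra (I.map φ) : Set (Polynomial S)) := by
  ext g
  constructor
  · rintro ⟨f, hf, rfl⟩ i
    rw [Polynomial.coeff_map, ← Ideal.map_pow]
    exact Ideal.mem_map_of_mem φ (hf i)
  · intro hg
    have hlift : ∀ i, ∃ r ∈ I ^ i, φ r = g.coeff i := fun i =>
      (Ideal.mem_map_iff_of_surjective φ hφ).1 (Ideal.map_pow φ I i ▸ hg i)
    choose r hr hrg using hlift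
    refine ⟨∑ i ∈ g.support, Polynomial.monomial i (r i),
      sum_mem fun i _ => reesAlgebra.monomial_mem.2 (hr i), ?_⟩
    simp only [Polynomial.map_sum, Polynomial.map_monomial, hrg]
    exact g.as_sum_support.symm

/-- The coefficientwise reduction map `R[X] → (R/N)[X]` modulo the nilradical
`N` maps the Rees algebra of an ideal `I` surjectively onto the Rees algebra of
the image ideal, and every element of the Rees algebra of `I` mapping to `0`
is nilpotent. -/
theorem reesAlgebra_map_nilradical {R : Type*} [CommRing R] (I : Ideal R) :
    (Polynomial.map (Ideal.Quotient.mk (nilradical R)) ''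
        (reesAlgebra I : Set (Polynomial R)) =
      (reesAlgebra (I.map (Ideal.Quotient.mk (nilradical R))) :
        Set (Polynomial (R ⧸ nilradical R)))) ∧
    ∀ f ∈ reesAlgebra I,
      Polynomial.map (Ideal.Quotient.mk (nilradical R)) f = 0 → IsNilpotent f := by
  refine ⟨image_map_reesAlgebra_of_surjective I Ideal.Quotient.mk_surjective,
    fun f _ hf => Polynomial.isNilpotent_iff.2 fun i => ?_⟩
  rw [← mem_nilradical, ← Ideal.Quotient.eq_zero_iff_mem, ← Polynomial.coeff_map, hf,
    Polynomial.coeff_zero]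
end
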